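/- arXiv:1607.01186 — 3 statements merged into one kernel-verified Lean document; each statement's English description precedes it below -/
import Mathlib

section
/- The extended-real-valued function Φ : ℝ × ℝ^d → [0, ∞] is lower semicontinuous. -/
open scoped ENNReal
open scoped Classical

/-- The Benamou–Brenier integrand `Φ(ρ, m) = ‖m‖²/ρ` for `ρ > 0`,
`Φ(0,0) = 0`, and `Φ = +∞` otherwise. -/
noncomputable def BBPhi (d : ℕ) (p : ℝ × EuclideanSpace ℝ (Fin d)) : ℝ≥0∞ :=
  if 0 < p.1 then ENNReal.ofReal (‖p.2‖ ^ 2 / p.1)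
  else if p.1 = 0 ∧ p.2 = 0 then 0
  else ∞

theorem BBPhi_le_ofReal_iff {d : ℕ} {c : ℝ} (hc : 0 ≤ c) (p : ℝ × EuclideanSpace ℝ (Fin d)) :
    BBPhi d p ≤ ENNReal.ofReal c ↔ 0 ≤ p.1 ∧ ‖p.2‖ ^ 2 ≤ c * p.1 := by
  obtain ⟨ρ, m⟩ := p
  rcases lt_trichotomy ρ 0 with h | rfl | h
  · simp [BBPhi, h.not_gt, h.ne, h.not_ge]
  · by_cases hm : m = 0 <;> simp [BBPhi, hm]
  · simp [BBPhi, h, h.le, ENNReal.ofReal_le_ofReal_iff hc, div_le_iff₀ h]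

theorem benamou_brenier_integrand_lsc (d : ℕ) (hd : 1 ≤ d) :
    LowerSemicontinuous (BBPhi d) := by
  rw [lowerSemicontinuous_iff_isClosed_preimage]
  intro y
  by_cases hy : y = ∞
  · simp [hy]
  · have h : BBPhi d ⁻¹' Set.Iic y = {p | 0 ≤ p.1 ∧ ‖p.2‖ ^ 2 ≤ y.toReal * p.1} := by
      ext p
      rw [Set.mem_preimage, Set.mem_Iic, Set.mem_ofPred_eq,
        ← BBPhi_le_ofReal_iff ENNReal.toReal_nonneg, ENNReal.ofReal_toReal hy]
    rw [h]
    exact (isClosed_le continuous_const continuous_fst).inter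
      (isClosed_le (continuous_snd.norm.pow 2) (continuous_const.mul continuous_fst))
end

section
/- For every (ρ, m) ∈ ℝ × ℝ^d, Φ(ρ, m) equals the supremum, taken in [0, ∞], of the quantities a ρ + ⟨b, m⟩ over all pairs (a, b) ∈ ℝ × ℝ^d satisfying a + ‖b‖²/4 ≤ 0 (where negative values of a ρ + ⟨b, m⟩ are truncated to 0, which does not affect the supremum since (a,b) = (0,0) is admissible). -/
open scoped ENNReal
open scoped Classical
open scoped RealInnerProductSpace

theorem benamou_brenier_integrand_dual_representation
    (d : ℕ) (hd : 1 ≤ d) (ρ : ℝ) (m : EuclideanSpace ℝ (Fin d)) :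
    BBPhi d (ρ, m)
      = ⨆ q : {q : ℝ × EuclideanSpace ℝ (Fin d) // q.1 + ‖q.2‖ ^ 2 / 4 ≤ 0},
          ENNReal.ofReal (q.1.1 * ρ + ⟪q.1.2, m⟫) := by
  have hle (q : {q : ℝ × EuclideanSpace ℝ (Fin d) // q.1 + ‖q.2‖ ^ 2 / 4 ≤ 0}) :
      ENNReal.ofReal (q.1.1 * ρ + ⟪q.1.2, m⟫) ≤
        ⨆ q : {q : ℝ × EuclideanSpace ℝ (Fin d) // q.1 + ‖q.2‖ ^ 2 / 4 ≤ 0},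
          ENNReal.ofReal (q.1.1 * ρ + ⟪q.1.2, m⟫) :=
    le_iSup (fun q : {q : ℝ × EuclideanSpace ℝ (Fin d) // q.1 + ‖q.2‖ ^ 2 / 4 ≤ 0} =>
      ENNReal.ofReal (q.1.1 * ρ + ⟪q.1.2, m⟫)) q
  unfold BBPhi
  dsimp only
  split_ifs with hρ h0
  · apply le_antisymm
    · refine le_trans (le_of_eq ?_) (hle ⟨(-(‖m‖ ^ 2 / ρ ^ 2), (2 / ρ) • m), ?_⟩)
      · congr 1
        simp only [real_inner_smul_left, real_inner_self_eq_norm_sq]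
        field_simp
        ring
      · simp only [norm_smul, mul_pow, Real.norm_eq_abs, sq_abs]
        apply le_of_eq
        field_simp
        ring
    · refine iSup_le fun ⟨⟨a, b⟩, hab⟩ => ENNReal.ofReal_le_ofReal ?_
      dsimp only at hab ⊢
      have hinner : ⟪b, m⟫ ≤ ‖b‖ * ‖m‖ := real_inner_le_norm b m
      have ha : a * ρ ≤ -(‖b‖ ^ 2 / 4) * ρ :=
        mul_le_mul_of_nonneg_right (by linarith) hρ.le
      have hsq : ‖m‖ ^ 2 / ρ - (-(‖b‖ ^ 2 / 4) * ρ + ‖b‖ * ‖m‖)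
          = (‖m‖ - ρ * ‖b‖ / 2) ^ 2 / ρ := by
        field_simp
        ring
      have hnonneg : 0 ≤ (‖m‖ - ρ * ‖b‖ / 2) ^ 2 / ρ := by positivity
      linarith
  · obtain ⟨rfl, rfl⟩ := h0
    simp
  · refine (ENNReal.eq_top_of_forall_nnreal_le fun r => ?_).symm
    rw [← ENNReal.ofReal_coe_nnreal]
    rcases (not_lt.mp hρ).lt_or_eq with hneg | rfl
    · refine le_trans (le_of_eq ?_) (hle ⟨(r / ρ, 0), ?_⟩)
      · simp [hneg.ne]
      · simpa using div_nonpos_of_nonneg_of_nonpos r.coe_nonneg hneg.le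
    · have hm : ‖m‖ ≠ 0 := norm_ne_zero_iff.mpr fun h => h0 ⟨rfl, h⟩
      refine le_trans (le_of_eq ?_)
        (hle ⟨(-(‖(r / ‖m‖ ^ 2 : ℝ) • m‖ ^ 2 / 4), (r / ‖m‖ ^ 2 : ℝ) • m), ?_⟩)
      · simp only [real_inner_smul_left, real_inner_self_eq_norm_sq]
        congr 1
        field_simp
        ring
      · simp
end

section
/- For every (a, b) ∈ ℝ × ℝ^d, the supremum of a ρ + ⟨b, m⟩ − Φ(ρ, m), taken over all (ρ, m) ∈ ℝ × ℝ^d for which Φ(ρ, m) is finite, equals 0 if a + ‖b‖²/4 ≤ 0, and equals +∞ otherwise. In other words, the Legendre–Fenchel conjugate Φ* of Φ is the indicator function of the convex set K = {(a, b) : a + ‖b‖²/4 ≤ 0}. -/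
open scoped ENNReal
open scoped Classical
open scoped RealInnerProductSpace

theorem BBPhi_of_pos {d : ℕ} {ρ : ℝ} (hρ : 0 < ρ) (m : EuclideanSpace ℝ (Fin d)) :
    BBPhi d (ρ, m) = ENNReal.ofReal (‖m‖ ^ 2 / ρ) :=
  if_pos hρ

theorem BBPhi_zero (d : ℕ) : BBPhi d 0 = 0 := by
  simp [BBPhi]

/-- Young's inequality for the perspective function of `‖·‖²`. -/
theorem inner_sub_norm_sq_div_le {E : Type*} [NormedAddCommGroup E] [InnerProductSpace ℝ E]
    {ρ : ℝ} (hρ : 0 < ρ) (b m : E) : ⟪b, m⟫ - ‖m‖ ^ 2 / ρ ≤ ρ * (‖b‖ ^ 2 / 4) := by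
  have hcs := real_inner_le_norm b m
  have hsq : ρ * (‖b‖ ^ 2 / 4) - ‖b‖ * ‖m‖ + ‖m‖ ^ 2 / ρ = (ρ * ‖b‖ / 2 - ‖m‖) ^ 2 / ρ := by
    field_simp
    ring
  have hnonneg : 0 ≤ (ρ * ‖b‖ / 2 - ‖m‖) ^ 2 / ρ := by positivity
  linarith

theorem affine_sub_BBPhi_le {d : ℕ} (a : ℝ) (b : EuclideanSpace ℝ (Fin d))
    {p : ℝ × EuclideanSpace ℝ (Fin d)} (hp : BBPhi d p ≠ ∞) (hab : a + ‖b‖ ^ 2 / 4 ≤ 0) :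
    a * p.1 + ⟪b, p.2⟫ - (BBPhi d p).toReal ≤ 0 := by
  obtain ⟨ρ, m⟩ := p
  by_cases hρ : 0 < ρ
  · rw [BBPhi_of_pos hρ, ENNReal.toReal_ofReal (by positivity)]
    have hyoung := inner_sub_norm_sq_div_le hρ b m
    have hscale := mul_nonpos_of_nonneg_of_nonpos hρ.le hab
    linarith
  · by_cases hzero : ρ = 0 ∧ m = 0
    · simp [hzero.1, hzero.2]
    · simp [BBPhi, hρ, hzero] at hp

/-- Young's inequality is attained at `m = (ρ / 2) b`. -/
theorem affine_sub_BBPhi_eq {d : ℕ} (a : ℝ) (b : EuclideanSpace ℝ (Fin d)) {ρ : ℝ} (hρ : 0 < ρ) :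
    a * ρ + ⟪b, (ρ / 2) • b⟫ - (BBPhi d (ρ, (ρ / 2) • b)).toReal = ρ * (a + ‖b‖ ^ 2 / 4) := by
  rw [BBPhi_of_pos hρ, ENNReal.toReal_ofReal (by positivity), inner_smul_right,
    real_inner_self_eq_norm_sq, norm_smul, Real.norm_of_nonneg (by positivity)]
  field_simp
  ring

/-- The Legendre–Fenchel conjugate of the Benamou–Brenier integrand `Φ` is the
indicator function of the convex set `K = {(a,b) : a + ‖b‖²/4 ≤ 0}`. -/
theorem benamou_brenier_integrand_conjugate
    (d : ℕ) (hd : 1 ≤ d) (a : ℝ) (b : EuclideanSpace ℝ (Fin d)) :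
    (⨆ p : {p : ℝ × EuclideanSpace ℝ (Fin d) // BBPhi d p ≠ ∞},
        ((a * p.1.1 + ⟪b, p.1.2⟫ - (BBPhi d p).toReal : ℝ) : EReal))
      = if a + ‖b‖ ^ 2 / 4 ≤ 0 then (0 : EReal) else (⊤ : EReal) := by
  split_ifs with hab
  · apply le_antisymm
    · exact iSup_le fun p => by exact_mod_cast affine_sub_BBPhi_le a b p.2 hab
    · refine le_iSup_of_le ⟨0, by simp [BBPhi_zero]⟩ ?_
      simp [BBPhi_zero]
  · push Not at hab
    rw [EReal.eq_top_iff_forall_lt]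
    intro y
    obtain ⟨ρ, hρ, hval⟩ : ∃ ρ : ℝ, 0 < ρ ∧ ρ * (a + ‖b‖ ^ 2 / 4) = |y| + 1 :=
      ⟨(|y| + 1) / (a + ‖b‖ ^ 2 / 4), by positivity, div_mul_cancel₀ _ hab.ne'⟩
    have hfin : BBPhi d (ρ, (ρ / 2) • b) ≠ ∞ := by
      rw [BBPhi_of_pos hρ]
      exact ENNReal.ofReal_ne_top
    refine lt_of_lt_of_le ?_ (le_iSup _ ⟨(ρ, (ρ / 2) • b), hfin⟩)
    rw [EReal.coe_lt_coe_iff, affine_sub_BBPhi_eq a b hρ, hval]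
    linarith [le_abs_self y]
end
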